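/- Let d ≥ 1, T > 0, c > 0, U = (0,1)^d with boundary Γ and closure Ū; for 1 ≤ i ≤ d let Γ^{i,+} = {u ∈ Γ : u_i = 0} and Γ^{i,−} = {u ∈ Γ : u_i = 1}. Let g : Γ → ℝ be continuous and let ρ : [0,T] × Ū → ℝ be smooth, satisfy the heat equation ∂_t ρ(t,u) = Δρ(t,u) for all (t,u) ∈ (0,T] × U, and satisfy the Robin boundary conditions: for each i and all t ∈ [0,T], ∂_{u_i}ρ(t,u) = c (g(u) − ρ(t,u)) for u ∈ Γ^{i,−} and ∂_{u_i}ρ(t,u) = c (ρ(t,u) − g(u)) for u ∈ Γ^{i,+}. Then max_{(t,u) ∈ [0,T] × Ū} ρ(t,u) ≤ max{ max_{u ∈ Ū} ρ(0,u), max_{u ∈ Γ} g(u) }. -/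

import Mathlib

open scoped BigOperators
open Finset Filter

noncomputable section

/-- The open hypercube `U = (0,1)^d`. -/
def cubeO (d : ℕ) : Set (Fin d → ℝ) := {u | ∀ i, u i ∈ Set.Ioo (0 : ℝ) 1}

/-- The closed hypercube `Ū = [0,1]^d`. -/
def cubeC (d : ℕ) : Set (Fin d → ℝ) := {u | ∀ i, u i ∈ Set.Icc (0 : ℝ) 1}

/-- The boundary `Γ = Ū \ U`. -/
def cubeB (d : ℕ) : Set (Fin d → ℝ) := cubeC d \ cubeO d

/-- `Γ^{i,+} = {u ∈ Γ : u_i = 0}`. -/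
def GammaP (d : ℕ) (i : Fin d) : Set (Fin d → ℝ) := {u | u ∈ cubeB d ∧ u i = 0}

/-- `Γ^{i,-} = {u ∈ Γ : u_i = 1}`. -/
def GammaM (d : ℕ) (i : Fin d) : Set (Fin d → ℝ) := {u | u ∈ cubeB d ∧ u i = 1}

/-- Partial derivative in the `i`-th spatial coordinate (one-sided at the boundary
of `[0,1]`). -/
def pderiv (d : ℕ) (i : Fin d) (f : (Fin d → ℝ) → ℝ) (u : Fin d → ℝ) : ℝ :=
  derivWithin (fun s => f (Function.update u i s)) (Set.Icc 0 1) (u i)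

theorem cubeC_eq_pi (d : ℕ) : cubeC d = Set.univ.pi fun _ => Set.Icc (0 : ℝ) 1 := by
  ext u; simp only [cubeC, Set.mem_ofPred_eq, Set.mem_univ_pi]

theorem cubeO_eq_pi (d : ℕ) : cubeO d = Set.univ.pi fun _ => Set.Ioo (0 : ℝ) 1 := by
  ext u; simp only [cubeO, Set.mem_ofPred_eq, Set.mem_univ_pi]

theorem isCompact_cubeC (d : ℕ) : IsCompact (cubeC d) := by
  rw [cubeC_eq_pi]; exact isCompact_univ_pi fun _ => isCompact_Icc

theorem isOpen_cubeO (d : ℕ) : IsOpen (cubeO d) := by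
  rw [cubeO_eq_pi]; exact isOpen_set_pi Set.finite_univ fun _ _ => isOpen_Ioo

theorem isCompact_cubeB (d : ℕ) : IsCompact (cubeB d) :=
  (isCompact_cubeC d).diff (isOpen_cubeO d)

theorem update_mem_cubeC {d : ℕ} {u : Fin d → ℝ} (hu : u ∈ cubeC d) (i : Fin d) {s : ℝ}
    (hs : s ∈ Set.Icc (0 : ℝ) 1) : Function.update u i s ∈ cubeC d := by
  intro j
  rcases eq_or_ne j i with rfl | hj
  · simpa using hs
  · simpa [Function.update_of_ne hj] using hu j

/-- A one-sided first-order condition at a maximum: the derivative is nonpositive along any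
direction pointing into the set. -/
theorem IsMaxOn.hasDerivWithinAt_mul_sub_nonpos {f : ℝ → ℝ} {f' x y : ℝ} {s : Set ℝ}
    (hmax : IsMaxOn f s x) (hf : HasDerivWithinAt f f' s x) (hxy : segment ℝ x y ⊆ s) :
    (y - x) * f' ≤ 0 := by
  simpa using hmax.localize.hasFDerivWithinAt_nonpos hf.hasFDerivWithinAt
    (sub_mem_posTangentConeAt_of_segment_subset hxy)

theorem IsMaxOn.derivWithin_mul_sub_nonpos {f : ℝ → ℝ} {x y : ℝ} {s : Set ℝ}
    (hmax : IsMaxOn f s x) (hxy : segment ℝ x y ⊆ s) : (y - x) * derivWithin f s x ≤ 0 := by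
  by_cases hf : DifferentiableWithinAt ℝ f s x
  · exact hmax.hasDerivWithinAt_mul_sub_nonpos hf.hasDerivWithinAt hxy
  · simp [derivWithin_zero_of_not_differentiableWithinAt hf]

theorem IsLocalMax.deriv_deriv_nonpos {f : ℝ → ℝ} {x : ℝ} (hmax : IsLocalMax f x)
    (hf : ContinuousAt f x) : deriv (deriv f) x ≤ 0 := by
  by_contra! h
  have hmin : IsLocalMin f x := isLocalMin_of_deriv_deriv_pos h hmax.deriv_eq_zero hf
  have hconst : f =ᶠ[nhds x] fun _ => f x := by
    filter_upwards [hmax, hmin] with y h1 h2 using le_antisymm h1 h2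
  have := hconst.deriv.deriv_eq
  simp at this
  exact h.ne' this

theorem IsMaxOn.derivWithin_derivWithin_nonpos {f : ℝ → ℝ} {s : Set ℝ} {x : ℝ}
    (hmax : IsMaxOn f s x) (hf : ContinuousOn f s) (hs : s ∈ nhds x) :
    derivWithin (derivWithin f s) s x ≤ 0 := by
  have heq : derivWithin f s =ᶠ[nhds x] deriv f := by
    filter_upwards [eventually_mem_nhds_iff.2 hs] with y hy using derivWithin_of_mem_nhds hy
  rw [derivWithin_of_mem_nhds hs, heq.deriv_eq]
  exact (hmax.isLocalMax hs).deriv_deriv_nonpos (hf.continuousAt hs)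

/-- At an interior maximum over the cube, the pure second partial derivatives are nonpositive. -/
theorem pderiv_pderiv_nonpos {d : ℕ} {f : (Fin d → ℝ) → ℝ} {u : Fin d → ℝ}
    (hmax : IsMaxOn f (cubeC d) u) (hf : ContinuousOn f (cubeC d)) (hu : u ∈ cubeO d)
    (i : Fin d) : pderiv d i (pderiv d i f) u ≤ 0 := by
  have huC : u ∈ cubeC d := fun j => Set.Ioo_subset_Icc_self (hu j)
  have hmax' : IsMaxOn (fun s => f (Function.update u i s)) (Set.Icc 0 1) (u i) := by
    intro s hs
    simpa using hmax (update_mem_cubeC huC i hs)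
  have hcont : ContinuousOn (fun s => f (Function.update u i s)) (Set.Icc 0 1) :=
    hf.comp (by fun_prop) fun s hs => update_mem_cubeC huC i hs
  simpa [pderiv] using hmax'.derivWithin_derivWithin_nonpos hcont (Icc_mem_nhds (hu i).1 (hu i).2)

/-- The one-sided first-order condition for a partial derivative at a maximum over the cube. -/
theorem sub_mul_pderiv_nonpos {d : ℕ} {f : (Fin d → ℝ) → ℝ} {u : Fin d → ℝ}
    (hmax : IsMaxOn f (cubeC d) u) (hu : u ∈ cubeC d) (i : Fin d) {y : ℝ}
    (hy : y ∈ Set.Icc (0 : ℝ) 1) : (y - u i) * pderiv d i f u ≤ 0 := by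
  have hmax' : IsMaxOn (fun s => f (Function.update u i s)) (Set.Icc 0 1) (u i) := by
    intro s hs
    simpa using hmax (update_mem_cubeC hu i hs)
  exact hmax'.derivWithin_mul_sub_nonpos ((convex_Icc 0 1).segment_subset (hu i) hy)

theorem exists_eq_zero_or_eq_one_of_mem_cubeB {d : ℕ} {u : Fin d → ℝ} (hu : u ∈ cubeB d) :
    ∃ i, u i = 0 ∨ u i = 1 := by
  by_contra! h
  exact hu.2 fun i => ⟨(hu.1 i).1.lt_of_ne' (h i).1, (hu.1 i).2.lt_of_ne (h i).2⟩

/-- **Maximum principle, Robin case** (Theorem 5.1 of the paper, θ = 1): a smooth solution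
of the heat equation on `(0,T] × U` with Robin boundary conditions is bounded above by the
maximum of its initial values and of the boundary data `g`. -/
theorem maximum_principle_robin
    (d : ℕ) (hd : 1 ≤ d) (T c : ℝ) (hT : 0 < T) (hc : 0 < c)
    (g : (Fin d → ℝ) → ℝ) (hg : ContinuousOn g (cubeB d))
    (ρ : ℝ → (Fin d → ℝ) → ℝ)
    (hρ_smooth : ContDiffOn ℝ (⊤ : ℕ∞) (fun p : ℝ × (Fin d → ℝ) => ρ p.1 p.2)
      (Set.Icc 0 T ×ˢ cubeC d))
    (hheat : ∀ t ∈ Set.Ioc (0 : ℝ) T, ∀ u ∈ cubeO d,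
      HasDerivWithinAt (fun s => ρ s u)
        (∑ i, pderiv d i (pderiv d i (ρ t)) u) (Set.Ioc 0 T) t)
    (hbc : ∀ t ∈ Set.Icc (0 : ℝ) T, ∀ i : Fin d,
      (∀ u ∈ GammaM d i, pderiv d i (ρ t) u = c * (g u - ρ t u)) ∧
      (∀ u ∈ GammaP d i, pderiv d i (ρ t) u = c * (ρ t u - g u))) :
    sSup {r : ℝ | ∃ t ∈ Set.Icc (0 : ℝ) T, ∃ u ∈ cubeC d, r = ρ t u}
      ≤ max (sSup {r : ℝ | ∃ u ∈ cubeC d, r = ρ 0 u})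
          (sSup {r : ℝ | ∃ u ∈ cubeB d, r = g u}) := by
  set M := max (sSup {r : ℝ | ∃ u ∈ cubeC d, r = ρ 0 u})
    (sSup {r : ℝ | ∃ u ∈ cubeB d, r = g u}) with hM
  have hcont : ContinuousOn (fun p : ℝ × (Fin d → ℝ) => ρ p.1 p.2)
      (Set.Icc 0 T ×ˢ cubeC d) := hρ_smooth.continuousOn
  have hcont_slice : ∀ t ∈ Set.Icc (0 : ℝ) T, ContinuousOn (ρ t) (cubeC d) := fun t ht =>
    hcont.comp (f := fun u => (t, u)) (by fun_prop) fun u hu => ⟨ht, hu⟩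
  have hinit : ∀ u ∈ cubeC d, ρ 0 u ≤ M := by
    intro u hu
    refine le_max_of_le_left (le_csSup ?_ ⟨u, hu, rfl⟩)
    refine ((isCompact_cubeC d).bddAbove_image (hcont_slice 0 ⟨le_rfl, hT.le⟩)).mono ?_
    rintro _ ⟨v, hv, rfl⟩
    exact ⟨v, hv, rfl⟩
  have hbdry : ∀ u ∈ cubeB d, g u ≤ M := by
    intro u hu
    refine le_max_of_le_right (le_csSup ?_ ⟨u, hu, rfl⟩)
    refine ((isCompact_cubeB d).bddAbove_image hg).mono ?_
    rintro _ ⟨v, hv, rfl⟩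
    exact ⟨v, hv, rfl⟩
  have h0 : (fun _ => 0 : Fin d → ℝ) ∈ cubeC d := fun _ => ⟨le_rfl, zero_le_one⟩
  refine csSup_le ⟨_, 0, ⟨le_rfl, hT.le⟩, _, h0, rfl⟩ ?_
  rintro _ ⟨t₁, ht₁, u₁, hu₁, rfl⟩
  by_contra! hlt
  obtain ⟨ε, hε, hεT⟩ : ∃ ε > 0, ε * T < ρ t₁ u₁ - M := by
    refine ⟨(ρ t₁ u₁ - M) / (2 * T), by have := sub_pos.2 hlt; positivity, ?_⟩
    have : (ρ t₁ u₁ - M) / (2 * T) * T = (ρ t₁ u₁ - M) / 2 := by field_simp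
    linarith
  -- The maximum of the penalized function `ρ t u - ε t` exceeds `M`.
  obtain ⟨⟨t, u⟩, ⟨ht, hu⟩, hmax⟩ := (isCompact_Icc.prod (isCompact_cubeC d)).exists_isMaxOn
    ⟨(t₁, u₁), ht₁, hu₁⟩ (f := fun p => ρ p.1 p.2 - ε * p.1)
    (hcont.sub (continuousOn_const.mul continuousOn_fst))
  simp only at ht hu
  have hle : ∀ s ∈ Set.Icc (0 : ℝ) T, ∀ v ∈ cubeC d, ρ s v - ε * s ≤ ρ t u - ε * t :=
    fun s hs v hv => hmax (show (s, v) ∈ Set.Icc 0 T ×ˢ cubeC d from ⟨hs, hv⟩)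
  have hgt : M < ρ t u - ε * t := by
    have := hle t₁ ht₁ u₁ hu₁
    have := mul_le_mul_of_nonneg_left ht₁.2 hε.le
    linarith
  have ht_pos : 0 < t := by
    refine ht.1.lt_of_ne ?_
    rintro rfl
    linarith [hinit u hu]
  have hρ_gt : M < ρ t u := by linarith [mul_pos hε ht_pos]
  have hspace : IsMaxOn (ρ t) (cubeC d) u := fun v hv => by
    simpa using hle t ht v hv
  by_cases huO : u ∈ cubeO d
  · have hlap : ∑ i, pderiv d i (pderiv d i (ρ t)) u ≤ 0 :=
      Finset.sum_nonpos fun i _ => pderiv_pderiv_nonpos hspace (hcont_slice t ht) huO i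
    have htime : IsMaxOn (fun s => ρ s u - ε * s) (Set.Ioc 0 T) t := fun s hs =>
      hle s ⟨hs.1.le, hs.2⟩ u hu
    have hderiv := (hheat t ⟨ht_pos, ht.2⟩ u huO).sub
      ((hasDerivWithinAt_id t (Set.Ioc 0 T)).const_mul ε)
    have := htime.hasDerivWithinAt_mul_sub_nonpos (y := t / 2) hderiv
      ((convex_Ioc 0 T).segment_subset ⟨ht_pos, ht.2⟩ ⟨by linarith, by linarith [ht.2]⟩)
    nlinarith
  · have huB : u ∈ cubeB d := ⟨hu, huO⟩
    have hflux : 0 < c * (ρ t u - g u) := mul_pos hc (by linarith [hbdry u huB])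
    obtain ⟨i, hi | hi⟩ := exists_eq_zero_or_eq_one_of_mem_cubeB huB
    · have := sub_mul_pderiv_nonpos hspace hu i (y := 1) ⟨zero_le_one, le_rfl⟩
      rw [(hbc t ht i).2 u ⟨huB, hi⟩, hi] at this
      linarith
    · have := sub_mul_pderiv_nonpos hspace hu i (y := 0) ⟨le_rfl, zero_le_one⟩
      rw [(hbc t ht i).1 u ⟨huB, hi⟩, hi] at this
      linarith

end
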